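/- In the presented Lie algebra D̃, the following identities hold for all i, j, k ∈ I, all m, n, p ∈ ℤ, and each choice of sign ±: if i = j or a_{ij} = 0, then [[x^±_{i,m}, x^±_{j,n}], x^∓_{k,p}] = 0; and if a_{ij} < 0, then [[x^±_{i,m+1}, x^±_{j,n}], x^∓_{k,p}] = [[x^±_{i,m}, x^±_{j,n+1}], x^∓_{k,p}]. (These identities are the coefficients of the formal-distribution identity f_{ij}(z,w)·[[x_i^±(z), x_j^±(w)], x_k^∓(w')] = 0.) -/

import Mathlib

/-! Common setup: the presented Lie algebra `D̃` associated to a generalized Cartan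
matrix `A` and positive rationals `(ε_i)`. -/

/-- Generators of the presentation: `h_{i,m}`, `x⁺_{i,m}`, `x⁻_{i,m}` and `c`. -/
inductive DGen (I : Type) : Type
  | h : I → ℤ → DGen I
  | xp : I → ℤ → DGen I
  | xm : I → ℤ → DGen I
  | c : DGen I

/-- The free Lie algebra on the generators. -/
abbrev DFree (I : Type) := FreeLieAlgebra ℂ (DGen I)

namespace DFree

variable {I : Type}

noncomputable def H (i : I) (m : ℤ) : DFree I := FreeLieAlgebra.of ℂ (DGen.h i m)
noncomputable def Xp (i : I) (m : ℤ) : DFree I := FreeLieAlgebra.of ℂ (DGen.xp i m)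
noncomputable def Xm (i : I) (m : ℤ) : DFree I := FreeLieAlgebra.of ℂ (DGen.xm i m)
noncomputable def C (I : Type) : DFree I := FreeLieAlgebra.of ℂ (DGen.c : DGen I)

end DFree

/-- The defining relations of `D̃`:
`[h_{i,m}, c] = 0 = [x^±_{i,m}, c]`;
`[h_{i,m}, h_{j,n}] = (m/ε_j) a_{ij} δ_{m+n,0} c`;
`[h_{i,m}, x^±_{j,n}] = ± a_{ij} x^±_{j,m+n}`;
`[x⁺_{i,m}, x⁻_{j,n}] = δ_{ij} (h_{j,m+n} + (m/ε_j) δ_{m+n,0} c)`. -/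
noncomputable def tildeRels {I : Type} [DecidableEq I] (A : I → I → ℤ) (ε : I → ℚ) :
    Set (DFree I) :=
  (Set.range fun p : I × ℤ => ⁅DFree.H p.1 p.2, DFree.C I⁆) ∪
  (Set.range fun p : I × ℤ => ⁅DFree.Xp p.1 p.2, DFree.C I⁆) ∪
  (Set.range fun p : I × ℤ => ⁅DFree.Xm p.1 p.2, DFree.C I⁆) ∪
  (Set.range fun p : (I × ℤ) × (I × ℤ) =>
    ⁅DFree.H p.1.1 p.1.2, DFree.H p.2.1 p.2.2⁆ -
      (if p.1.2 + p.2.2 = 0 then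
          (p.1.2 : ℂ) / (ε p.2.1 : ℂ) * (A p.1.1 p.2.1 : ℂ)
        else 0) • DFree.C I) ∪
  (Set.range fun p : (I × ℤ) × (I × ℤ) =>
    ⁅DFree.H p.1.1 p.1.2, DFree.Xp p.2.1 p.2.2⁆ -
      (A p.1.1 p.2.1 : ℂ) • DFree.Xp p.2.1 (p.1.2 + p.2.2)) ∪
  (Set.range fun p : (I × ℤ) × (I × ℤ) =>
    ⁅DFree.H p.1.1 p.1.2, DFree.Xm p.2.1 p.2.2⁆ +
      (A p.1.1 p.2.1 : ℂ) • DFree.Xm p.2.1 (p.1.2 + p.2.2)) ∪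
  (Set.range fun p : (I × ℤ) × (I × ℤ) =>
    ⁅DFree.Xp p.1.1 p.1.2, DFree.Xm p.2.1 p.2.2⁆ -
      (if p.1.1 = p.2.1 then
          DFree.H p.2.1 (p.1.2 + p.2.2) +
            (if p.1.2 + p.2.2 = 0 then (p.1.2 : ℂ) / (ε p.2.1 : ℂ) else 0) • DFree.C I
        else 0))

/-- The Lie ideal of the free Lie algebra generated by the relations. -/
noncomputable def tildeIdeal {I : Type} [DecidableEq I] (A : I → I → ℤ) (ε : I → ℚ) :
    LieIdeal ℂ (DFree I) :=
  LieSubmodule.lieSpan ℂ (DFree I) (tildeRels A ε)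

/-- The presented Lie algebra `D̃`. -/
abbrev DTilde {I : Type} [DecidableEq I] (A : I → I → ℤ) (ε : I → ℚ) : Type :=
  DFree I ⧸ tildeIdeal A ε

namespace DTilde

variable {I : Type} [DecidableEq I] (A : I → I → ℤ) (ε : I → ℚ)

noncomputable def h (i : I) (m : ℤ) : DTilde A ε :=
  LieSubmodule.Quotient.mk' (tildeIdeal A ε) (DFree.H i m)

noncomputable def xp (i : I) (m : ℤ) : DTilde A ε :=
  LieSubmodule.Quotient.mk' (tildeIdeal A ε) (DFree.Xp i m)

noncomputable def xm (i : I) (m : ℤ) : DTilde A ε :=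
  LieSubmodule.Quotient.mk' (tildeIdeal A ε) (DFree.Xm i m)

noncomputable def c : DTilde A ε :=
  LieSubmodule.Quotient.mk' (tildeIdeal A ε) (DFree.C I)

end DTilde

/-- `A` is a generalized Cartan matrix. -/
def IsGCM {I : Type} (A : I → I → ℤ) : Prop :=
  (∀ i, A i i = 2) ∧ (∀ i j, i ≠ j → A i j ≤ 0) ∧ (∀ i j, A i j = 0 ↔ A j i = 0)

/-- Indecomposability of `A`. -/
def IsIndecomposable {I : Type} (A : I → I → ℤ) : Prop :=
  ∀ i j : I, Relation.ReflTransGen (fun p q => A p q ≠ 0) i j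

/-- The principal minor of `A` indexed by a finite subset `S` of `I`. -/
noncomputable def principalMinor {I : Type} [DecidableEq I] (A : I → I → ℤ)
    (S : Finset I) : ℚ :=
  Matrix.det (fun p q : S => (A p.1 q.1 : ℚ))

/-- `A` is of finite or affine type: every principal minor of `A` is positive, or `A` is
indecomposable with `det A = 0` and every proper principal minor positive. -/
def IsFinOrAffType {I : Type} [Fintype I] [DecidableEq I] (A : I → I → ℤ) : Prop :=
  (∀ S : Finset I, 0 < principalMinor A S) ∨
    (IsIndecomposable A ∧ principalMinor A Finset.univ = 0 ∧
      ∀ S : Finset I, S ≠ Finset.univ → 0 < principalMinor A S)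

namespace DTilde

section Relations

variable {I : Type} [DecidableEq I] (A : I → I → ℤ) (ε : I → ℚ)

theorem mk_eq_zero_of_mem_tildeRels {r : DFree I} (hr : r ∈ tildeRels A ε) :
    LieSubmodule.Quotient.mk' (tildeIdeal A ε) r = 0 := by
  rw [LieSubmodule.Quotient.mk_eq_zero]
  exact LieSubmodule.subset_lieSpan hr

theorem mk_lie (a b : DFree I) :
    LieSubmodule.Quotient.mk' (tildeIdeal A ε) ⁅a, b⁆ =
      ⁅LieSubmodule.Quotient.mk' (tildeIdeal A ε) a,
        LieSubmodule.Quotient.mk' (tildeIdeal A ε) b⁆ :=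
  LieSubmodule.Quotient.mk_bracket (tildeIdeal A ε) a b

theorem xp_lie_c (i : I) (m : ℤ) : ⁅xp A ε i m, c A ε⁆ = 0 := by
  have hr : ⁅DFree.Xp i m, DFree.C I⁆ ∈ tildeRels A ε :=
    Or.inl <| Or.inl <| Or.inl <| Or.inl <| Or.inl <| Or.inr ⟨(i, m), rfl⟩
  exact mk_eq_zero_of_mem_tildeRels A ε hr

theorem xm_lie_c (i : I) (m : ℤ) : ⁅xm A ε i m, c A ε⁆ = 0 := by
  have hr : ⁅DFree.Xm i m, DFree.C I⁆ ∈ tildeRels A ε :=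
    Or.inl <| Or.inl <| Or.inl <| Or.inl <| Or.inr ⟨(i, m), rfl⟩
  exact mk_eq_zero_of_mem_tildeRels A ε hr

theorem xp_lie_h (i j : I) (m n : ℤ) :
    ⁅xp A ε j n, h A ε i m⁆ = -((A i j : ℂ) • xp A ε j (m + n)) := by
  have hr : ⁅DFree.H i m, DFree.Xp j n⁆ - (A i j : ℂ) • DFree.Xp j (m + n) ∈ tildeRels A ε :=
    Or.inl <| Or.inl <| Or.inr ⟨((i, m), (j, n)), rfl⟩
  have e := mk_eq_zero_of_mem_tildeRels A ε hr
  rw [map_sub, map_smul, mk_lie, sub_eq_zero] at e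
  rw [← lie_skew]
  exact congrArg Neg.neg e

theorem xm_lie_h (i j : I) (m n : ℤ) :
    ⁅xm A ε j n, h A ε i m⁆ = (A i j : ℂ) • xm A ε j (m + n) := by
  have hr : ⁅DFree.H i m, DFree.Xm j n⁆ + (A i j : ℂ) • DFree.Xm j (m + n) ∈ tildeRels A ε :=
    Or.inl <| Or.inr ⟨((i, m), (j, n)), rfl⟩
  have e := mk_eq_zero_of_mem_tildeRels A ε hr
  rw [map_add, map_smul, mk_lie, add_eq_zero_iff_neg_eq] at e
  rw [← lie_skew]
  exact e

theorem xp_lie_xm_of_ne {i j : I} (hij : i ≠ j) (m n : ℤ) :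
    ⁅xp A ε i m, xm A ε j n⁆ = 0 := by
  have e := mk_eq_zero_of_mem_tildeRels A ε (Or.inr ⟨((i, m), (j, n)), rfl⟩)
  simp only [if_neg hij, sub_zero] at e
  rwa [mk_lie] at e

theorem exists_xp_lie_xm (i : I) (m n : ℤ) :
    ∃ t : ℂ, ⁅xp A ε i m, xm A ε i n⁆ = h A ε i (m + n) + t • c A ε := by
  have e := mk_eq_zero_of_mem_tildeRels A ε (Or.inr ⟨((i, m), (i, n)), rfl⟩)
  simp only [if_true] at e
  rw [map_sub, map_add, map_smul, mk_lie, sub_eq_zero] at e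
  exact ⟨_, e⟩

theorem xp_lie_xp_lie_xm (i j k : I) (m n p : ℤ) :
    ⁅xp A ε i m, ⁅xp A ε j n, xm A ε k p⁆⁆ =
      if j = k then -((A j i : ℂ) • xp A ε i (m + n + p)) else 0 := by
  split_ifs with hjk
  · subst hjk
    obtain ⟨t, ht⟩ := exists_xp_lie_xm A ε j n p
    rw [ht, lie_add, lie_smul, xp_lie_c, xp_lie_h, smul_zero, add_zero,
      show n + p + m = m + n + p by ring]
  · rw [xp_lie_xm_of_ne A ε hjk, lie_zero]

theorem xm_lie_xm_lie_xp (i j k : I) (m n p : ℤ) :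
    ⁅xm A ε i m, ⁅xm A ε j n, xp A ε k p⁆⁆ =
      if j = k then -((A j i : ℂ) • xm A ε i (m + n + p)) else 0 := by
  rw [← lie_skew (xm A ε j n), lie_neg]
  split_ifs with hjk
  · subst hjk
    obtain ⟨t, ht⟩ := exists_xp_lie_xm A ε j p n
    rw [ht, lie_add, lie_smul, xm_lie_c, xm_lie_h, smul_zero, add_zero,
      show p + n + m = m + n + p by ring]
  · rw [xp_lie_xm_of_ne A ε (Ne.symm hjk), lie_zero, neg_zero]

theorem lie_xp_xp_lie_xm (i j k : I) (m n p : ℤ) :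
    ⁅⁅xp A ε i m, xp A ε j n⁆, xm A ε k p⁆ =
      (if j = k then -((A j i : ℂ) • xp A ε i (m + n + p)) else 0) -
        if i = k then -((A i j : ℂ) • xp A ε j (m + n + p)) else 0 := by
  rw [lie_lie, xp_lie_xp_lie_xm, xp_lie_xp_lie_xm, add_comm n m]

theorem lie_xm_xm_lie_xp (i j k : I) (m n p : ℤ) :
    ⁅⁅xm A ε i m, xm A ε j n⁆, xp A ε k p⁆ =
      (if j = k then -((A j i : ℂ) • xm A ε i (m + n + p)) else 0) -
        if i = k then -((A i j : ℂ) • xm A ε j (m + n + p)) else 0 := by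
  rw [lie_lie, xm_lie_xm_lie_xp, xm_lie_xm_lie_xp, add_comm n m]

end Relations

end DTilde

/-- identities in `D̃`: for all `i, j, k ∈ I`, `m, n, p ∈ ℤ` and each sign,
if `i = j` or `a_{ij} = 0` then `[[x^±_{i,m}, x^±_{j,n}], x^∓_{k,p}] = 0`, and if
`a_{ij} < 0` then
`[[x^±_{i,m+1}, x^±_{j,n}], x^∓_{k,p}] = [[x^±_{i,m}, x^±_{j,n+1}], x^∓_{k,p}]`. -/
theorem stmt10 {I : Type} [Fintype I] [DecidableEq I]
    (A : I → I → ℤ) (hGCM : IsGCM A) (hFA : IsFinOrAffType A)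
    (ε : I → ℚ) (hε : ∀ i, 0 < ε i)
    (hsym : ∀ i j, (ε i : ℚ) * (A i j : ℚ) = (ε j : ℚ) * (A j i : ℚ))
    (i j k : I) (m n p : ℤ) :
    ((i = j ∨ A i j = 0) →
      ⁅⁅DTilde.xp A ε i m, DTilde.xp A ε j n⁆, DTilde.xm A ε k p⁆ = 0 ∧
      ⁅⁅DTilde.xm A ε i m, DTilde.xm A ε j n⁆, DTilde.xp A ε k p⁆ = 0) ∧
    (A i j < 0 →
      ⁅⁅DTilde.xp A ε i (m + 1), DTilde.xp A ε j n⁆, DTilde.xm A ε k p⁆ =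
        ⁅⁅DTilde.xp A ε i m, DTilde.xp A ε j (n + 1)⁆, DTilde.xm A ε k p⁆ ∧
      ⁅⁅DTilde.xm A ε i (m + 1), DTilde.xm A ε j n⁆, DTilde.xp A ε k p⁆ =
        ⁅⁅DTilde.xm A ε i m, DTilde.xm A ε j (n + 1)⁆, DTilde.xp A ε k p⁆) := by
  simp only [DTilde.lie_xp_xp_lie_xm, DTilde.lie_xm_xm_lie_xp]
  refine ⟨?_, fun _ => by simp only [add_right_comm m 1 n, add_assoc m n 1, and_self]⟩
  rintro (rfl | h0)
  · simp only [sub_self, and_self]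
  · simp [h0, (hGCM.2.2 i j).1 h0]
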